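/- (Spacelike Björling representation.) Let I ⊆ ℝ be a nonempty open interval and let X : D'(I) → ℝ³ be a real-analytic conformal timelike minimal immersion, where D'(I) = {(t,s) ∈ ℝ² : s+t ∈ I and s−t ∈ I}. Set γ(s) = X(0,s) and W(s) = N(0,s), where N = (X_t ×ₗ X_s)/√⟨X_t ×ₗ X_s, X_t ×ₗ X_s⟩ is the Gauss map. Then for all (t,s) ∈ D'(I): X(t,s) = ½(γ(s+t) + γ(s−t)) + ½ ∫_{s−t}^{s+t} W(τ) ×ₗ γ'(τ) dτ. -/

import Mathlib

/-- Partial derivative in the first (t) coordinate. -/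
noncomputable def pdt {E : Type*} [NormedAddCommGroup E] [NormedSpace ℝ E]
    (f : ℝ × ℝ → E) (p : ℝ × ℝ) : E := deriv (fun x => f (x, p.2)) p.1

/-- Partial derivative in the second (s) coordinate. -/
noncomputable def pds {E : Type*} [NormedAddCommGroup E] [NormedSpace ℝ E]
    (f : ℝ × ℝ → E) (p : ℝ × ℝ) : E := deriv (fun y => f (p.1, y)) p.2

/-- The Minkowski inner product on ℝ³ = ℝ × ℝ × ℝ: ⟨x,y⟩ = -x₁y₁ + x₂y₂ + x₃y₃. -/
def mink (x y : ℝ × ℝ × ℝ) : ℝ := -(x.1 * y.1) + x.2.1 * y.2.1 + x.2.2 * y.2.2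

/-- The Lorentzian cross product on ℝ³, characterized by ⟨u ×ₗ v, w⟩ = det[u,v,w]. -/
def lcross (u v : ℝ × ℝ × ℝ) : ℝ × ℝ × ℝ :=
  (-(u.2.1 * v.2.2 - u.2.2 * v.2.1), u.2.2 * v.1 - u.1 * v.2.2, u.1 * v.2.1 - u.2.1 * v.1)

/-- Reflected diamond domain D'(I) = {(t,s) : s+t ∈ I and s−t ∈ I}. -/
def diamond' (I : Set ℝ) : Set (ℝ × ℝ) := {p | p.2 + p.1 ∈ I ∧ p.2 - p.1 ∈ I}

/-- The Gauss map N = (X_t ×ₗ X_s)/√⟨X_t ×ₗ X_s, X_t ×ₗ X_s⟩ of a timelike surface. -/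
noncomputable def gaussN (X : ℝ × ℝ → ℝ × ℝ × ℝ) (p : ℝ × ℝ) : ℝ × ℝ × ℝ :=
  (Real.sqrt (mink (lcross (pdt X p) (pds X p)) (lcross (pdt X p) (pds X p))))⁻¹ •
    lcross (pdt X p) (pds X p)

theorem isOpen_diamond' {I : Set ℝ} (hI : IsOpen I) : IsOpen (diamond' I) :=
  (hI.preimage (continuous_snd.add continuous_fst)).inter
    (hI.preimage (continuous_snd.sub continuous_fst))

theorem convex_diamond' {I : Set ℝ} (hI : Convex ℝ I) : Convex ℝ (diamond' I) := by
  rintro ⟨t, s⟩ ⟨h1, h2⟩ ⟨t', s'⟩ ⟨h1', h2'⟩ a b ha hb hab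
  constructor
  · convert hI h1 h1' ha hb hab using 1
    simp only [Prod.smul_mk, Prod.mk_add_mk, smul_eq_mul]
    ring
  · convert hI h2 h2' ha hb hab using 1
    simp only [Prod.smul_mk, Prod.mk_add_mk, smul_eq_mul]
    ring

section PartialDerivatives

variable {E : Type*} [NormedAddCommGroup E] [NormedSpace ℝ E]

theorem pdt_eq_fderiv {f : ℝ × ℝ → E} {p : ℝ × ℝ} (hf : DifferentiableAt ℝ f p) :
    pdt f p = fderiv ℝ f p (1, 0) :=
  HasDerivAt.deriv (HasFDerivAt.comp_hasDerivAt (f := fun x : ℝ => (x, p.2)) p.1 hf.hasFDerivAt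
    ((hasDerivAt_id p.1).prodMk (hasDerivAt_const p.1 p.2)))

theorem pds_eq_fderiv {f : ℝ × ℝ → E} {p : ℝ × ℝ} (hf : DifferentiableAt ℝ f p) :
    pds f p = fderiv ℝ f p (0, 1) :=
  HasDerivAt.deriv (HasFDerivAt.comp_hasDerivAt (f := fun y : ℝ => (p.1, y)) p.2 hf.hasFDerivAt
    ((hasDerivAt_const p.2 p.1).prodMk (hasDerivAt_id p.2)))

theorem eq_of_hasDerivAt_zero {f : ℝ → E} {a b : ℝ}
    (hf : ∀ x ∈ Set.uIcc a b, HasDerivAt f 0 x) : f b = f a := by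
  have h := (convex_uIcc a b).norm_image_sub_le_of_norm_hasDerivWithin_le (C := 0)
    (fun x hx => (hf x hx).hasDerivWithinAt) (by simp) Set.left_mem_uIcc Set.right_mem_uIcc
  simpa [sub_eq_zero] using h

variable [CompleteSpace E]

theorem fderiv_fderiv_of_wave {D : Set (ℝ × ℝ)} (hD : IsOpen D) {X : ℝ × ℝ → E}
    (hX : AnalyticOnNhd ℝ X D) {p : ℝ × ℝ} (hp : p ∈ D)
    (hwave : pdt (pdt X) p = pds (pds X) p) {e : ℝ} (he : e * e = 1) :
    fderiv ℝ (fderiv ℝ X) p (1, -e) (1, e) = 0 := by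
  have hd : DifferentiableAt ℝ (fderiv ℝ X) p := (hX p hp).fderiv.differentiableAt
  have happ (v : ℝ × ℝ) : HasFDerivAt (fun q => fderiv ℝ X q v)
      ((ContinuousLinearMap.apply ℝ E v).comp (fderiv ℝ (fderiv ℝ X) p)) p :=
    (ContinuousLinearMap.apply ℝ E v).hasFDerivAt.comp p hd.hasFDerivAt
  have ht : pdt X =ᶠ[nhds p] fun q => fderiv ℝ X q (1, 0) := by
    filter_upwards [hD.mem_nhds hp] with q hq
    exact pdt_eq_fderiv (hX q hq).differentiableAt
  have hs : pds X =ᶠ[nhds p] fun q => fderiv ℝ X q (0, 1) := by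
    filter_upwards [hD.mem_nhds hp] with q hq
    exact pds_eq_fderiv (hX q hq).differentiableAt
  have ht' := (happ (1, 0)).congr_of_eventuallyEq ht
  have hs' := (happ (0, 1)).congr_of_eventuallyEq hs
  rw [pdt_eq_fderiv ht'.differentiableAt, pds_eq_fderiv hs'.differentiableAt, ht'.fderiv,
    hs'.fderiv] at hwave
  have hsymm : fderiv ℝ (fderiv ℝ X) p (1, 0) (0, 1) = fderiv ℝ (fderiv ℝ X) p (0, 1) (1, 0) :=
    (hX p hp).contDiffAt.isSymmSndFDerivAt (n := 2) (by simp) (1, 0) (0, 1)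
  have h1 : ((1, -e) : ℝ × ℝ) = (1, 0) - e • (0, 1) := by simp
  have h2 : ((1, e) : ℝ × ℝ) = (1, 0) + e • (0, 1) := by simp
  simp only [ContinuousLinearMap.comp_apply, ContinuousLinearMap.apply_apply] at hwave
  rw [h1, h2]
  simp only [map_sub, map_add, map_smul, sub_apply, smul_apply, hwave, hsymm]
  linear_combination (norm := module) (-he) • fderiv ℝ (fderiv ℝ X) p (0, 1) (0, 1)

theorem fderiv_eq_of_wave {D : Set (ℝ × ℝ)} (hD : IsOpen D) (hc : Convex ℝ D) {X : ℝ × ℝ → E}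
    (hX : AnalyticOnNhd ℝ X D) (hwave : ∀ p ∈ D, pdt (pdt X) p = pds (pds X) p) {e : ℝ}
    (he : e * e = 1) {t s : ℝ} (hp : (t, s) ∈ D) (hp0 : (0, s + e * t) ∈ D) :
    fderiv ℝ X (t, s) (1, e) = fderiv ℝ X (0, s + e * t) (1, e) := by
  have key (x : ℝ) (hx : x ∈ Set.uIcc (0 : ℝ) 1) :
      HasDerivAt (fun x : ℝ => fderiv ℝ X (x * t, s + e * t - x * t * e) (1, e)) 0 x := by
    rw [Set.uIcc_of_le zero_le_one] at hx
    have hmem : (x * t, s + e * t - x * t * e) ∈ D := by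
      convert hc hp0 hp (sub_nonneg.2 hx.2) hx.1 (by ring) using 1
      ext <;> simp
      ring
    have hpath : HasDerivAt (fun x : ℝ => (x * t, s + e * t - x * t * e)) (t • (1, -e)) x := by
      have h := (hasDerivAt_id x).mul_const t
      refine (h.prodMk ((h.mul_const e).const_sub (s + e * t))).congr_deriv ?_
      simp
    have hd := (hX _ hmem).fderiv.differentiableAt.hasFDerivAt.comp_hasDerivAt x hpath
    have h := (ContinuousLinearMap.apply ℝ E ((1, e) : ℝ × ℝ)).hasFDerivAt.comp_hasDerivAt x hd
    refine h.congr_deriv ?_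
    rw [map_smul, map_smul, ContinuousLinearMap.apply_apply,
      fderiv_fderiv_of_wave hD hX hmem (hwave _ hmem) he, smul_zero]
  have h := eq_of_hasDerivAt_zero key
  have h1 : s + e * t - t * e = s := by ring
  simpa [h1] using h

/-- Solution formula for the wave equation on a reflected diamond. -/
theorem dAlembert_diamond' {I : Set ℝ} (hI : IsOpen I) (hord : I.OrdConnected) {X : ℝ × ℝ → E}
    (hX : AnalyticOnNhd ℝ X (diamond' I))
    (hwave : ∀ p ∈ diamond' I, pdt (pdt X) p = pds (pds X) p) {t s : ℝ}
    (hp : (t, s) ∈ diamond' I) :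
    X (t, s) = (1 / 2 : ℝ) • (X (0, s + t) + X (0, s - t)) +
      (1 / 2 : ℝ) • ∫ τ in (s - t)..(s + t), pdt X (0, τ) := by
  have hD := isOpen_diamond' hI
  have hc := convex_diamond' hord.convex
  have haxis {τ : ℝ} (hτ : τ ∈ I) : ((0, τ) : ℝ × ℝ) ∈ diamond' I := by
    simpa [diamond'] using hτ
  have hs : s ∈ I := by
    have h := hord.convex hp.1 hp.2 one_half_pos.le one_half_pos.le
      (add_halves (1 : ℝ))
    convert h using 1
    simp only [smul_eq_mul]
    ring
  have hcont : ContinuousOn (fun τ => pdt X (0, τ)) I := by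
    have h : ContinuousOn (fun τ : ℝ => fderiv ℝ X (0, τ) (1, 0)) I := fun τ hτ =>
      (((hX _ (haxis hτ)).fderiv.continuousAt.comp
        (f := fun τ : ℝ => ((0, τ) : ℝ × ℝ)) (by fun_prop)).clm_apply
          continuousAt_const).continuousWithinAt
    exact h.congr fun τ hτ => pdt_eq_fderiv (hX _ (haxis hτ)).differentiableAt
  have hint {a b : ℝ} (ha : a ∈ I) (hb : b ∈ I) :
      IntervalIntegrable (fun τ => pdt X (0, τ)) MeasureTheory.volume a b :=
    (hcont.mono (hord.uIcc_subset ha hb)).intervalIntegrable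
  have hprim {a : ℝ} (ha : a ∈ I) :
      HasDerivAt (fun u => ∫ τ in s..u, pdt X (0, τ)) (pdt X (0, a)) a :=
    intervalIntegral.integral_hasDerivAt_right (hint hs ha)
      (hcont.stronglyMeasurableAtFilter hI a ha) (hcont.continuousAt (hI.mem_nhds ha))
  have hγ {a : ℝ} (ha : a ∈ I) :
      HasDerivAt (fun u : ℝ => X (0, u)) (fderiv ℝ X (0, a) (0, 1)) a :=
    (hX _ (haxis ha)).differentiableAt.hasFDerivAt.comp_hasDerivAt a
      ((hasDerivAt_const a (0 : ℝ)).prodMk (hasDerivAt_id a))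
  have key (x : ℝ) (hx : x ∈ Set.uIcc 0 t) :
      HasDerivAt (fun x : ℝ => X (x, s) - ((1 / 2 : ℝ) • (X (0, s + x) + X (0, s - x)) +
        (1 / 2 : ℝ) • ((∫ τ in s..(s + x), pdt X (0, τ)) - ∫ τ in s..(s - x), pdt X (0, τ))))
        0 x := by
    have hxD : (x, s) ∈ diamond' I := by
      have hoc : Set.OrdConnected {x : ℝ | (x, s) ∈ diamond' I} := by
        have h : Convex ℝ {x : ℝ | (x, s) ∈ diamond' I} := fun y hy z hz a b ha hb hab => by
          have := hc hy hz ha hb hab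
          simpa [← add_mul, hab] using this
        exact h.ordConnected
      exact hoc.uIcc_subset (haxis hs) hp hx
    have hplus : HasDerivAt (fun x : ℝ => s + x) 1 x := (hasDerivAt_id x).const_add s
    have hminus : HasDerivAt (fun x : ℝ => s - x) (-1) x := (hasDerivAt_id x).const_sub s
    have hXx : HasDerivAt (fun x : ℝ => X (x, s)) (fderiv ℝ X (x, s) (1, 0)) x :=
      (hX _ hxD).differentiableAt.hasFDerivAt.comp_hasDerivAt x
        ((hasDerivAt_id x).prodMk (hasDerivAt_const x s))
    have hd := hXx.sub ((((hγ hxD.1).scomp x hplus).add ((hγ hxD.2).scomp x hminus)).const_smul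
      (1 / 2 : ℝ) |>.add ((((hprim hxD.1).scomp x hplus).sub
        ((hprim hxD.2).scomp x hminus)).const_smul (1 / 2 : ℝ)))
    refine hd.congr_deriv ?_
    have hV := fderiv_eq_of_wave hD hc hX hwave (e := 1) (by norm_num) hxD
      (haxis (by simpa using hxD.1))
    have hU := fderiv_eq_of_wave hD hc hX hwave (e := -1) (by norm_num) hxD
      (haxis (by simpa [← sub_eq_add_neg] using hxD.2))
    have h1 : ((1, 1) : ℝ × ℝ) = (1, 0) + (0, 1) := by simp
    have h2 : ((1, -1) : ℝ × ℝ) = (1, 0) - (0, 1) := by simp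
    rw [h1, map_add, map_add, one_mul] at hV
    rw [h2, map_sub, map_sub, neg_one_mul, ← sub_eq_add_neg] at hU
    simp only at hxD ⊢
    rw [pdt_eq_fderiv (hX _ (haxis hxD.1)).differentiableAt,
      pdt_eq_fderiv (hX _ (haxis hxD.2)).differentiableAt]
    linear_combination (norm := module) (1 / 2 : ℝ) • hV + (1 / 2 : ℝ) • hU
  have h := eq_of_hasDerivAt_zero key
  simp only [add_zero, sub_zero, intervalIntegral.integral_same, smul_zero] at h
  rw [← two_smul ℝ (X (0, s)), smul_smul] at h
  norm_num at h
  rw [intervalIntegral.integral_interval_sub_left (hint hs hp.1) (hint hs hp.2), sub_eq_zero] at h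
  simpa using h

end PartialDerivatives

theorem lcross_lcross (u v w : ℝ × ℝ × ℝ) :
    lcross (lcross u v) w = mink v w • u - mink u w • v := by
  ext <;> simp [lcross, mink] <;> ring

theorem mink_lcross_self (u v : ℝ × ℝ × ℝ) :
    mink (lcross u v) (lcross u v) = mink u v ^ 2 - mink u u * mink v v := by
  simp only [lcross, mink]
  ring

theorem lcross_smul_left (c : ℝ) (u v : ℝ × ℝ × ℝ) : lcross (c • u) v = c • lcross u v := by
  ext <;> simp [lcross] <;> ring

theorem lcross_gaussN_pds {X : ℝ × ℝ → ℝ × ℝ × ℝ} {p : ℝ × ℝ}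
    (h1 : mink (pdt X p) (pdt X p) + mink (pds X p) (pds X p) = 0)
    (h2 : mink (pdt X p) (pds X p) = 0) (h3 : mink (pdt X p) (pdt X p) < 0) :
    lcross (gaussN X p) (pds X p) = pdt X p := by
  have hpos : 0 < mink (pds X p) (pds X p) := by linarith
  have hsq : mink (lcross (pdt X p) (pds X p)) (lcross (pdt X p) (pds X p)) =
      mink (pds X p) (pds X p) ^ 2 := by
    rw [mink_lcross_self, h2, eq_neg_of_add_eq_zero_left h1]
    ring
  rw [gaussN, lcross_smul_left, lcross_lcross, hsq, Real.sqrt_sq hpos.le, h2, zero_smul, sub_zero,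
    smul_smul, inv_mul_cancel₀ hpos.ne', one_smul]

/-- Spacelike Björling representation: a real-analytic conformal timelike minimal
immersion X on D'(I) is recovered from γ(s) = X(0,s) and W(s) = N(0,s) by
X(t,s) = ½(γ(s+t) + γ(s−t)) + ½ ∫_{s−t}^{s+t} W(τ) ×ₗ γ'(τ) dτ. -/
theorem stmt10 (I : Set ℝ) (hI : IsOpen I) (hne : I.Nonempty) (hord : I.OrdConnected)
    (X : ℝ × ℝ → ℝ × ℝ × ℝ) (hX : AnalyticOnNhd ℝ X (diamond' I))
    (hconf : ∀ p ∈ diamond' I,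
      mink (pdt X p) (pdt X p) + mink (pds X p) (pds X p) = 0 ∧
      mink (pdt X p) (pds X p) = 0 ∧
      mink (pdt X p) (pdt X p) < 0 ∧
      pdt (pdt X) p = pds (pds X) p) :
    ∀ p ∈ diamond' I,
      X p = (1 / 2 : ℝ) • (X (0, p.2 + p.1) + X (0, p.2 - p.1)) +
        (1 / 2 : ℝ) • ∫ τ in (p.2 - p.1)..(p.2 + p.1),
          lcross (gaussN X (0, τ)) (deriv (fun s => X (0, s)) τ) := by
  rintro ⟨t, s⟩ hp
  rw [dAlembert_diamond' hI hord hX (fun q hq => (hconf q hq).2.2.2) hp]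
  congr 2
  refine intervalIntegral.integral_congr fun τ hτ => ?_
  have hτ' : ((0, τ) : ℝ × ℝ) ∈ diamond' I := by
    simpa [diamond'] using hord.uIcc_subset hp.2 hp.1 hτ
  obtain ⟨h1, h2, h3, -⟩ := hconf _ hτ'
  exact (lcross_gaussN_pds h1 h2 h3).symm
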